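/- Let V be a finite-dimensional complex vector space, let F = (V_0,…,V_k) be a partial flag of type d in V, and let 𝔭_F = {x ∈ End(V) : x(V_p) ⊆ V_p for all p}. Let 𝔦 ⊆ 𝔭_F be a linear subspace with [𝔭_F, 𝔦] ⊆ 𝔦. If x ∈ 𝔦 and c ∈ ℂ are such that the endomorphism x + c·id_V is nilpotent, then x + c·id_V ∈ 𝔦. -/

import Mathlib

open Module Submodule

section aux
variable {V : Type*} [AddCommGroup V] [Module ℂ V]

lemma aux_trace [FiniteDimensional ℂ V] (f : Module.End ℂ V →ₗ[ℂ] ℂ) :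
    ∃ z : Module.End ℂ V, ∀ y, f y = LinearMap.trace ℂ V (z * y) := by
  let T : Module.End ℂ V →ₗ[ℂ] Module.Dual ℂ (Module.End ℂ V) :=
    (LinearMap.mul ℂ (Module.End ℂ V)).compr₂ (LinearMap.trace ℂ V)
  have hinj : Function.Injective T := by
    rw [← LinearMap.ker_eq_bot, LinearMap.ker_eq_bot']
    intro z hz
    ext v
    rw [LinearMap.zero_apply, ← Module.forall_dual_apply_eq_zero_iff ℂ]
    intro φ
    have h := LinearMap.congr_fun hz (φ.smulRight v)
    have h2 : z * (φ.smulRight v) = φ.smulRight (z v) := by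
      ext w; simp
    have h3 : LinearMap.trace ℂ V (z * (φ.smulRight v)) = 0 := h
    rw [h2, LinearMap.trace_smulRight] at h3
    exact h3
  have hs : Function.Surjective T :=
    (LinearMap.injective_iff_surjective_of_finrank_eq_finrank
      (Subspace.dual_finrank_eq).symm).1 hinj
  obtain ⟨z, hz⟩ := hs f
  exact ⟨z, fun y => by rw [← hz]; rfl⟩

lemma aux_h [FiniteDimensional ℂ V] (N : Module.End ℂ V) (hN : IsNilpotent N) :
    ∃ h : Module.End ℂ V, h * N - N * h = N := by
  let A : Module.End ℂ V →ₗ[ℂ] Module.End ℂ V :=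
    LinearMap.mulRight ℂ N - LinearMap.mulLeft ℂ N
  by_contra hcon
  have hnot : N ∉ LinearMap.range A := by
    rintro ⟨h, hh⟩
    exact hcon ⟨h, by simpa [A] using hh⟩
  obtain ⟨f, hf1, hf2⟩ := Submodule.exists_le_ker_of_notMem hnot
  obtain ⟨z, hz⟩ := aux_trace f
  obtain ⟨w, hw⟩ := aux_trace (0 : Module.End ℂ V →ₗ[ℂ] ℂ)
  have hcomm : N * z - z * N = 0 := by
    ext v
    rw [LinearMap.zero_apply, ← Module.forall_dual_apply_eq_zero_iff ℂ]
    intro φ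
    have h1 : f (A (φ.smulRight v)) = 0 := hf2 ⟨_, rfl⟩
    rw [hz] at h1
    have h2 : LinearMap.trace ℂ V ((N * z - z * N) * (φ.smulRight v)) = 0 := by
      rw [← h1]
      simp only [A, LinearMap.sub_apply, LinearMap.mulRight_apply, LinearMap.mulLeft_apply,
        mul_sub, sub_mul, map_sub]
      rw [mul_assoc N z, LinearMap.trace_mul_comm ℂ N, mul_assoc, mul_assoc]
    have h3 : (N * z - z * N) * (φ.smulRight v) = φ.smulRight ((N * z - z * N) v) := by
      ext w; simp
    rw [h3, LinearMap.trace_smulRight] at h2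
    exact h2
  apply hf1
  rw [hz]
  have hc : Commute z N := (sub_eq_zero.1 hcomm).symm
  exact (LinearMap.isNilpotent_trace_of_isNilpotent (hc.isNilpotent_mul_left hN)).eq_zero

lemma aux_e (F : ℕ → Submodule ℂ V) (hF : Monotone F) :
    ∃ e : ℕ → Module.End ℂ V, (∀ m v, e m v ∈ F m) ∧ (∀ m, ∀ v ∈ F m, e m v = v) ∧
      ∀ i j, Commute (e i) (e j) := by
  have hπ : ∀ m, ∃ π : Module.End ℂ V, (∀ v, π v ∈ F m) ∧ ∀ v ∈ F m, π v = v := by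
    intro m
    obtain ⟨g, hg⟩ := (F m).exists_isCompl
    refine ⟨(F m).subtype ∘ₗ (F m).projectionOnto g hg, fun v => by simp, fun v hv => ?_⟩
    have := Submodule.projectionOnto_apply_left hg ⟨v, hv⟩
    exact congrArg Subtype.val this
  choose π h1 h2 using hπ
  let e : ℕ → Module.End ℂ V := fun m =>
    Nat.rec (π 0) (fun m em => em + (1 - em) * π (m+1) * (1 - em)) m
  have es : ∀ m, e (m+1) = e m + (1 - e m) * π (m+1) * (1 - e m) := fun m => rfl
  have P : ∀ m, (∀ v, e m v ∈ F m) ∧ (∀ v ∈ F m, e m v = v) := by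
    intro m
    induction m with
    | zero => exact ⟨h1 0, h2 0⟩
    | succ m ih =>
      obtain ⟨a, b⟩ := ih
      have a' : ∀ v, e m v ∈ F (m+1) := fun v => hF (Nat.le_succ m) (a v)
      constructor
      · intro v
        rw [es]
        simp only [LinearMap.add_apply, Module.End.mul_apply, LinearMap.sub_apply,
          Module.End.one_apply]
        exact add_mem (a' _) (sub_mem (h1 _ _) (a' _))
      · intro v hv
        rw [es]
        simp only [LinearMap.add_apply, Module.End.mul_apply, LinearMap.sub_apply,
          Module.End.one_apply]
        rw [h2 (m+1) (v - e m v) (sub_mem hv (a' _)), map_sub, b _ (a v)]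
        simp
  have idem : ∀ m, e m * e m = e m := fun m => by
    ext v; exact (P m).2 _ ((P m).1 v)
  have up : ∀ i j, i ≤ j → e j * e i = e i := fun i j h => by
    ext v; exact (P j).2 _ (hF h ((P i).1 v))
  have dn : ∀ i j, i ≤ j → e i * e j = e i := by
    intro i j h
    induction j, h using Nat.le_induction with
    | base => exact idem i
    | succ j h ih =>
      have : e j * e (j+1) = e j := by
        have z : e j * (1 - e j) = 0 := by rw [mul_sub, idem, mul_one, sub_self]
        rw [es, mul_add, ← mul_assoc, ← mul_assoc, z, idem, zero_mul, zero_mul, add_zero]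
      rw [← ih, mul_assoc, this]
  refine ⟨e, fun m => (P m).1, fun m => (P m).2, fun i j => ?_⟩
  rcases le_total i j with h | h
  · exact (dn i j h).trans (up i j h).symm
  · exact (up j i h).trans (dn j i h).symm

lemma aux_pres (F : Submodule ℂ V) (e y : Module.End ℂ V) (h1 : ∀ v, e v ∈ F)
    (h2 : ∀ v ∈ F, e v = v) (h : Commute y e) : ∀ v ∈ F, y v ∈ F := by
  intro v hv
  have : y (e v) = e (y v) := LinearMap.congr_fun h.eq v
  rw [h2 v hv] at this
  rw [this]; exact h1 _

/-- block-diagonal part stays nilpotent -/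
lemma aux_nil {R : Type*} [Ring R] (e N : R) (he : e * e = e) (hN : e * N * e = N * e)
    (h : IsNilpotent N) : IsNilpotent (N - (e * N - N * e)) := by
  obtain ⟨m, hm⟩ := h
  have key : ∀ m : ℕ, e * N ^ m * e = N ^ m * e ∧
      (N - (e * N - N * e)) ^ m = N ^ m - (e * N ^ m - N ^ m * e) := by
    intro m
    induction m with
    | zero => simp [he]
    | succ m ih =>
      obtain ⟨a, b⟩ := ih
      have a' : e * (N ^ m * e) = N ^ m * e := by rw [← mul_assoc, a]
      have hN' : e * (N * e) = N * e := by rw [← mul_assoc, hN]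
      have e4 : e * (e * N) = e * N := by rw [← mul_assoc, he]
      have e2 : e * (N ^ m * (N * e)) = N ^ m * (N * e) := by
        rw [← hN', ← mul_assoc (N ^ m) e, ← mul_assoc e, a']
      have e3 : e * (N ^ m * (e * N)) = N ^ m * (e * N) := by
        rw [← mul_assoc (N ^ m) e, ← mul_assoc e, a']
      constructor
      · rw [pow_succ]; simp only [mul_assoc]; exact e2
      · rw [pow_succ, b, pow_succ]
        simp only [mul_sub, sub_mul, mul_assoc, e2, e3, hN', e4]
        abel
  exact ⟨m, by rw [(key m).2, hm]; simp⟩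

end aux

/-- The set of nilpotent elements of a Lie ideal of the flag-stabilizer
algebra `𝔭_F ⊆ End(V)` is unchanged when the ideal is enlarged by scalar elements: if
`x ∈ 𝔦` and `x + c·id` is nilpotent, then `x + c·id ∈ 𝔦`. -/
theorem stmt_14 (V : Type*) [AddCommGroup V] [Module ℂ V] [FiniteDimensional ℂ V]
    (n k : ℕ) (hdimV : finrank ℂ V = n)
    (d : Fin (k + 1) → ℕ) (hd0 : d 0 = 0) (hdlast : d (Fin.last k) = n) (hdsm : StrictMono d)
    (F : Fin (k + 1) → Submodule ℂ V) (hFmono : Monotone F)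
    (hFdim : ∀ p, finrank ℂ (F p) = d p)
    (I : Submodule ℂ (Module.End ℂ V))
    (hIp : ∀ x ∈ I, ∀ p, (F p).map x ≤ F p)
    (hIdeal : ∀ y : Module.End ℂ V, (∀ p, (F p).map y ≤ F p) →
      ∀ x ∈ I, y * x - x * y ∈ I) :
    ∀ x ∈ I, ∀ c : ℂ, IsNilpotent (x + c • (1 : Module.End ℂ V)) →
      x + c • (1 : Module.End ℂ V) ∈ I := by
  intro x hx c hnil
  let G : ℕ → Submodule ℂ V := fun m => F ⟨min m k, by omega⟩
  have hG : Monotone G := fun i j h => hFmono (by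
    simp only [Fin.mk_le_mk]; omega)
  have hFG : ∀ p : Fin (k+1), F p = G p := fun p => by
    simp only [G]; congr 1; ext; simp; omega
  obtain ⟨e, e1, e2, ec⟩ := aux_e G hG
  have idem : ∀ m, e m * e m = e m := fun m => by
    ext v; exact e2 m _ (e1 m v)
  have pres : ∀ y : Module.End ℂ V, (∀ i < k + 1, Commute y (e i)) →
      ∀ p, (F p).map y ≤ F p := by
    intro y hy p
    rw [hFG, Submodule.map_le_iff_le_comap]
    exact aux_pres (G p) (e p) y (e1 p) (e2 p) (hy p p.2)
  have red : ∀ m, ∃ x' ∈ I, IsNilpotent (x' + c • (1 : Module.End ℂ V)) ∧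
      ∀ i < m, Commute x' (e i) := by
    intro m
    induction m with
    | zero => exact ⟨x, hx, hnil, by simp⟩
    | succ m ih =>
      obtain ⟨y, hy, hn, hc⟩ := ih
      have hye : e m * y * e m = y * e m := by
        ext v
        refine e2 m _ ?_
        exact hIp y hy _ (Submodule.mem_map_of_mem (e1 m v))
      refine ⟨y - (e m * y - y * e m),
        sub_mem hy (hIdeal _ (pres _ fun i _ => ec m i) y hy), ?_, ?_⟩
      · have := aux_nil (e m) (y + c • 1) (idem m)
          (by simp only [mul_add, add_mul, hye]; simp [idem]) hn
        have q : y - (e m * y - y * e m) + c • (1 : Module.End ℂ V) =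
            y + c • 1 - (e m * (y + c • 1) - (y + c • 1) * e m) := by
          rw [mul_add, add_mul, mul_smul_comm, smul_mul_assoc, mul_one, one_mul]; abel
        rw [q]; exact this
      · intro i hi
        rcases Nat.lt_succ_iff_lt_or_eq.1 hi with h | rfl
        · have a := hc i h
          have b := ec m i
          exact a.sub_left ((b.mul_left a).sub_left (a.mul_left b))
        · have : e i * (y * e i) = y * e i := by rw [← mul_assoc, hye]
          have t2 : e i * (e i * y) = e i * y := by rw [← mul_assoc, idem]
          simp only [Commute, SemiconjBy, mul_sub, sub_mul, mul_assoc, idem, this, t2]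
          abel
  obtain ⟨y, hy, hn, hc⟩ := red (k+1)
  set N := y + c • (1 : Module.End ℂ V) with hNdef
  have hNc : ∀ i < k+1, Commute N (e i) := fun i hi =>
    (hc i hi).add_left ((Commute.one_left _).smul_left c)
  have hh : ∀ m ≤ k+1, ∃ h : Module.End ℂ V, h * N - N * h = N ∧
      ∀ i < m, Commute h (e i) := by
    intro m
    induction m with
    | zero => intro _; obtain ⟨h, hh⟩ := aux_h N hn; exact ⟨h, hh, by simp⟩
    | succ m ih =>
      intro hm
      obtain ⟨h, h1, h2⟩ := ih (by omega)
      have hE := hNc m (by omega)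
      have idem' : (1 - e m) * (1 - e m) = 1 - e m := by
        simp [mul_sub, sub_mul, idem]
      have hE' : Commute N (1 - e m) := (Commute.one_right _).sub_right hE
      have gen : ∀ f : Module.End ℂ V, f * f = f → Commute N f →
          (f * h * f) * N - N * (f * h * f) = N * f := by
        intro f hf hNf
        calc (f * h * f) * N - N * (f * h * f) = f * (h * N - N * h) * f := by
              simp only [mul_sub, sub_mul, mul_assoc]
              rw [← hNf.eq, ← mul_assoc N f, hNf.eq, mul_assoc]
          _ = N * f := by rw [h1, ← hNf.eq, mul_assoc, hf]
      refine ⟨e m * h * e m + (1 - e m) * h * (1 - e m), ?_, ?_⟩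
      · have a := gen _ (idem m) hE
        have b := gen _ idem' hE'
        rw [add_mul (e m * h * e m), mul_add N, add_sub_add_comm, a, b]
        simp [mul_sub]
      · intro i hi
        rcases Nat.lt_succ_iff_lt_or_eq.1 hi with h | rfl
        · have a := h2 i h
          have b := ec m i
          have b' : Commute (1 - e m) (e i) := (Commute.one_left _).sub_left b
          exact ((b.mul_left a).mul_left b).add_left ((b'.mul_left a).mul_left b')
        · have z1 : (1 - e i) * e i = 0 := by simp [sub_mul, idem]
          have z2 : e i * (1 - e i) = 0 := by simp [mul_sub, idem]
          have l : (e i * h * e i + (1 - e i) * h * (1 - e i)) * e i = e i * h * e i := by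
            rw [add_mul, mul_assoc _ (1 - e i), z1, mul_assoc _ (e i), idem]; simp
          have r : e i * (e i * h * e i + (1 - e i) * h * (1 - e i)) = e i * h * e i := by
            rw [mul_add, mul_assoc (1 - e i), ← mul_assoc (e i) (1 - e i), z2,
              ← mul_assoc, ← mul_assoc, idem]; simp
          exact l.trans r.symm
  obtain ⟨h, h1, h2⟩ := hh (k+1) le_rfl
  have hNI : N ∈ I := by
    have := hIdeal h (pres h h2) y hy
    have e : h * y - y * h = N := by
      rw [← h1, hNdef]; simp only [mul_add, add_mul]; simp
    rwa [e] at this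
  have : x + c • (1 : Module.End ℂ V) = (x - y) + N := by rw [hNdef]; abel
  rw [this]
  exact add_mem (sub_mem hx hy) hNI
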